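/- (Generalization bound under a covering-number assumption; abstract form of the paper's Theorem 2.) Let (Z, 𝒜) be a measurable space with probability measure μ, let n ≥ 1, and let G be a nonempty countable family of measurable functions g : Z → [0, 1] containing the zero function. Suppose R > 0 is such that for every sample z = (z₁, …, zₙ) ∈ Zⁿ and every ε > 0, the set G(z) = { (g(z₁), …, g(zₙ)) : g ∈ G } ⊆ ℝⁿ admits an ε-cover (with respect to the Euclidean norm) of cardinality at most exp(R/ε²). Then for every δ ∈ (0, 1), with probability at least 1 − δ over an i.i.d. sample z drawn from μ^⊗n, simultaneously for all g ∈ G: E_{z∼μ}[g(z)] ≤ (1/n)·Σ_{i=1}^{n} g(zᵢ) + 8/n^{3/2} + (36/n)·√R·log n + 3·√(log(2/δ)/(2n)). -/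

import Mathlib

open MeasureTheory

/-- The Euclidean norm on `ℝⁿ`. -/
noncomputable def euclNorm {n : ℕ} (v : Fin n → ℝ) : ℝ :=
  Real.sqrt (∑ i, (v i) ^ 2)

open ProbabilityTheory
open scoped NNReal

/-- **McDiarmid's inequality**, in sub-Gaussian form. -/
theorem hasSubgaussianMGF_pi_of_bounded_difference {Z : Type*} [MeasurableSpace Z]
    (μ : Measure Z) [IsProbabilityMeasure μ] (c : ℝ≥0) :
    ∀ (n : ℕ) (f : (Fin n → Z) → ℝ), Measurable f → ∀ C : ℝ, (∀ z, |f z| ≤ C) →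
      (∀ z i x, |f (Function.update z i x) - f z| ≤ c) →
      HasSubgaussianMGF (fun z => f z - ∫ y, f y ∂Measure.pi (fun _ => μ)) (n * (c / 2) ^ 2)
        (Measure.pi fun _ : Fin n => μ) := by
  intro n
  induction n with
  | zero =>
    intro f _ C _ _
    have h : (fun z => f z - ∫ y, f y ∂Measure.pi (fun _ : Fin 0 => μ)) = fun _ => 0 := by
      funext z
      have : f = fun _ => f z := by funext y; rw [Subsingleton.elim y z]
      rw [this]
      simp
    rw [h]
    exact ⟨fun t => by simp, fun t => by simp [mgf]⟩
  | succ n ih =>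
    intro f hf C hC hdiff
    have : Nonempty Z := nonempty_of_isProbabilityMeasure μ
    set π := Measure.pi (fun _ : Fin n => μ)
    set e := MeasurableEquiv.piFinSuccAbove (fun _ : Fin (n + 1) => Z) 0
    have he : MeasurePreserving e (Measure.pi fun _ : Fin (n + 1) => μ) (μ.prod π) :=
      measurePreserving_piFinSuccAbove (fun _ => μ) 0
    have hes : ∀ p : Z × (Fin n → Z), e.symm p = Fin.cons p.1 p.2 := by
      intro p
      simp [e, MeasurableEquiv.piFinSuccAbove, Fin.insertNthEquiv]
    let k : Z × (Fin n → Z) → ℝ := fun p => f (e.symm p)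
    have hk : Measurable k := hf.comp e.symm.measurable
    have hkC : ∀ p, |k p| ≤ C := fun p => hC _
    have hkx : ∀ x x' y, k (x, y) ≤ k (x', y) + c := by
      intro x x' y
      have h := hdiff (Fin.cons x' y) 0 x
      rw [Fin.update_cons_zero] at h
      simp only [k, hes]
      linarith [(abs_le.1 h).2]
    have hki : Integrable k (μ.prod π) :=
      Integrable.of_bound hk.aestronglyMeasurable C (ae_of_all _ hkC)
    have hkxi : ∀ y, Integrable (fun x => k (x, y)) μ := fun y =>
      Integrable.of_bound (hk.comp measurable_prodMk_right).aestronglyMeasurable C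
        (ae_of_all _ fun x => hkC _)
    let h : (Fin n → Z) → ℝ := fun y => ∫ x, k (x, y) ∂μ
    have hh : Measurable h := (hk.stronglyMeasurable.integral_prod_left').measurable
    have hhC : ∀ y, |h y| ≤ C := fun y => by
      simpa using norm_integral_le_of_norm_le_const (μ := μ) (C := C) (f := fun x => k (x, y))
        (ae_of_all _ fun x => hkC (x, y))
    have hhd : ∀ y i x, |h (Function.update y i x) - h y| ≤ c := by
      intro y i a
      have h1 : ∀ x, |k (x, Function.update y i a) - k (x, y)| ≤ c := fun x => by
        simp only [k, hes, Fin.cons_update]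
        exact hdiff _ _ _
      simp only [h]
      rw [← integral_sub (hkxi _) (hkxi _)]
      simpa using norm_integral_le_of_norm_le_const (μ := μ) (C := c)
        (f := fun x => k (x, Function.update y i a) - k (x, y)) (ae_of_all _ h1)
    have IH := ih h hh C hhC hhd
    have hfk : ∀ z, f z = k (e z) := fun z => by simp [k]
    have hint : ∫ z, f z ∂Measure.pi (fun _ : Fin (n + 1) => μ) = ∫ y, h y ∂π := by
      simp_rw [hfk]
      rw [he.integral_comp' (g := k), integral_prod_symm _ hki]
    set m := ∫ y, h y ∂π
    rw [hint]
    have hinner : ∀ y, HasSubgaussianMGF (fun x => k (x, y) - h y) ((c / 2) ^ 2) μ := by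
      intro y
      have hbdd : BddBelow (Set.range fun x => k (x, y)) :=
        ⟨-C, by rintro _ ⟨x, rfl⟩; exact (abs_le.1 (hkC (x, y))).1⟩
      have := hasSubgaussianMGF_of_mem_Icc (μ := μ) (X := fun x => k (x, y))
        (a := ⨅ x, k (x, y)) (b := (⨅ x, k (x, y)) + c)
        (hk.comp measurable_prodMk_right).aemeasurable
        (ae_of_all _ fun x => ⟨ciInf_le hbdd x, by
          rw [← sub_le_iff_le_add]
          exact le_ciInf fun x' => by linarith [hkx x x' y]⟩)
      simpa using this
    have hbd : ∀ t : ℝ, Integrable (fun p => Real.exp (t * (k p - m))) (μ.prod π) := fun t => by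
      refine integrable_exp_mul_of_mem_Icc (a := -C - m) (b := C - m)
        (hk.sub_const m).aemeasurable (ae_of_all _ fun p => ?_)
      have := abs_le.1 (hkC p)
      exact ⟨by linarith, by linarith⟩
    refine ⟨fun t => ?_, fun t => ?_⟩
    · simp_rw [hfk]
      exact (he.integrable_comp_emb e.measurableEmbedding).2 (hbd t)
    · simp only [mgf]
      simp_rw [hfk]
      rw [he.integral_comp' (g := fun p => Real.exp (t * (k p - m))),
        integral_prod_symm _ (hbd t)]
      calc ∫ y, ∫ x, Real.exp (t * (k (x, y) - m)) ∂μ ∂π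
          ≤ ∫ y, Real.exp ((c / 2) ^ 2 * t ^ 2 / 2) * Real.exp (t * (h y - m)) ∂π := by
            refine integral_mono (hbd t).integral_prod_right
              ((IH.integrable_exp_mul t).const_mul _) fun y => ?_
            have h1 : ∀ x, Real.exp (t * (k (x, y) - m))
                = Real.exp (t * (k (x, y) - h y)) * Real.exp (t * (h y - m)) := fun x => by
              rw [← Real.exp_add]; ring_nf
            simp_rw [h1]
            rw [integral_mul_const]
            gcongr
            simpa [mgf] using (hinner y).mgf_le t
        _ = Real.exp ((c / 2) ^ 2 * t ^ 2 / 2) * mgf (fun y => h y - m) π t := by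
            rw [integral_const_mul]; rfl
        _ ≤ Real.exp ((c / 2) ^ 2 * t ^ 2 / 2)
              * Real.exp (((n * (c / 2) ^ 2 : ℝ≥0) : ℝ) * t ^ 2 / 2) := by
            gcongr
            exact IH.mgf_le t
        _ = _ := by
            rw [← Real.exp_add]
            push_cast
            ring_nf

theorem euclNorm_eq_norm_toLp {n : ℕ} (v : Fin n → ℝ) : euclNorm v = ‖WithLp.toLp 2 v‖ := by
  simp [euclNorm, EuclideanSpace.norm_eq]

theorem euclNorm_sub_le_add {n : ℕ} (u v w : Fin n → ℝ) :
    euclNorm (v - w) ≤ euclNorm (u - v) + euclNorm (u - w) := by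
  simp only [euclNorm_eq_norm_toLp, WithLp.toLp_sub]
  rw [norm_sub_rev (WithLp.toLp 2 u) (WithLp.toLp 2 v)]
  exact norm_sub_le_norm_sub_add_norm_sub _ _ _

theorem euclNorm_sq {n : ℕ} (v : Fin n → ℝ) : euclNorm v ^ 2 = ∑ i, v i ^ 2 :=
  Real.sq_sqrt (Finset.sum_nonneg fun _ _ => sq_nonneg _)

/-- The sign `1` or `-1` encoded by a Boolean. -/
def boolSign (b : Bool) : ℝ := if b then 1 else -1

theorem boolSign_sq (b : Bool) : boolSign b ^ 2 = 1 := by cases b <;> simp [boolSign]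

theorem boolSign_not (b : Bool) : boolSign (!b) = -boolSign b := by cases b <;> simp [boolSign]

/-- The signed sum `∑ i, σᵢ vᵢ` for a vector of signs `σ`. -/
noncomputable def signedSum {n : ℕ} (σ : Fin n → Bool) (v : Fin n → ℝ) : ℝ :=
  ∑ i, boolSign (σ i) * v i

theorem signedSum_add {n : ℕ} (σ : Fin n → Bool) (u v : Fin n → ℝ) :
    signedSum σ (u + v) = signedSum σ u + signedSum σ v := by
  simp [signedSum, mul_add, Finset.sum_add_distrib]

theorem signedSum_sub {n : ℕ} (σ : Fin n → Bool) (u v : Fin n → ℝ) :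
    signedSum σ (u - v) = signedSum σ u + signedSum (fun i => !σ i) v := by
  simp [signedSum, boolSign_not, sub_eq_add_neg, mul_add, Finset.sum_add_distrib]

theorem signedSum_le {n : ℕ} (σ : Fin n → Bool) (v : Fin n → ℝ) :
    signedSum σ v ≤ √n * euclNorm v := by
  have h := Real.sum_mul_le_sqrt_mul_sqrt Finset.univ (fun i => boolSign (σ i)) v
  simpa [boolSign_sq, signedSum, euclNorm] using h

theorem sum_exp_mul_signedSum_le {n : ℕ} (v : Fin n → ℝ) (s : ℝ) :
    ∑ σ, Real.exp (s * signedSum σ v) ≤ 2 ^ n * Real.exp (s ^ 2 * euclNorm v ^ 2 / 2) := by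
  have h1 : ∀ σ : Fin n → Bool, Real.exp (s * signedSum σ v)
      = ∏ i, Real.exp (s * (boolSign (σ i) * v i)) := fun σ => by
    rw [signedSum, Finset.mul_sum, Real.exp_sum]
  simp_rw [h1]
  rw [← Fintype.prod_sum (f := fun i b => Real.exp (s * (boolSign b * v i)))]
  calc ∏ i, ∑ b, Real.exp (s * (boolSign b * v i))
      ≤ ∏ i, 2 * Real.exp ((s * v i) ^ 2 / 2) := by
        refine Finset.prod_le_prod (fun i _ => by positivity) fun i _ => ?_
        have h2 := Real.cosh_le_exp_half_sq (s * v i)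
        rw [Real.cosh_eq] at h2
        simp only [Fintype.sum_bool, boolSign, if_true, Bool.false_eq_true, if_false]
        rw [show s * (1 * v i) = s * v i by ring, show s * (-1 * v i) = -(s * v i) by ring]
        linarith
    _ = 2 ^ n * Real.exp (s ^ 2 * euclNorm v ^ 2 / 2) := by
        rw [Finset.prod_mul_distrib, ← Real.exp_sum, euclNorm_sq, Finset.mul_sum, Finset.sum_div]
        simp [mul_pow]

/-- **Massart's finite class lemma**, with an explicit temperature `s`. -/
theorem exists_signedSum_le_of_finset {n : ℕ} (V : Finset (Fin n → ℝ)) {r s L : ℝ}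
    (hs : 0 < s) (hV : ∀ v ∈ V, euclNorm v ≤ r) (hL : (V.card : ℝ) ≤ Real.exp L) :
    ∃ M : (Fin n → Bool) → ℝ, (∀ σ, ∀ v ∈ V, signedSum σ v ≤ M σ) ∧
      ∑ σ, M σ ≤ 2 ^ n * ((L + s ^ 2 * r ^ 2 / 2) / s) := by
  set K := L + s ^ 2 * r ^ 2 / 2 with hK
  refine ⟨fun σ => (K - 1 + (∑ v ∈ V, Real.exp (s * signedSum σ v)) / Real.exp K) / s,
    fun σ v hv => ?_, ?_⟩
  · rw [le_div_iff₀ hs]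
    have h1 := Real.add_one_le_exp (s * signedSum σ v - K)
    rw [Real.exp_sub] at h1
    have h2 : Real.exp (s * signedSum σ v) / Real.exp K
        ≤ (∑ v ∈ V, Real.exp (s * signedSum σ v)) / Real.exp K := by
      gcongr
      exact Finset.single_le_sum (f := fun v => Real.exp (s * signedSum σ v))
        (fun _ _ => (Real.exp_pos _).le) hv
    linarith
  · have h3 : ∑ σ : Fin n → Bool, ∑ v ∈ V, Real.exp (s * signedSum σ v)
        ≤ 2 ^ n * Real.exp K := by
      rw [Finset.sum_comm]
      calc ∑ v ∈ V, ∑ σ : Fin n → Bool, Real.exp (s * signedSum σ v)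
          ≤ ∑ v ∈ V, 2 ^ n * Real.exp (s ^ 2 * r ^ 2 / 2) := by
            refine Finset.sum_le_sum fun v hv => (sum_exp_mul_signedSum_le v s).trans ?_
            have := hV v hv
            have h0 : 0 ≤ euclNorm v := Real.sqrt_nonneg _
            gcongr
        _ = V.card * (2 ^ n * Real.exp (s ^ 2 * r ^ 2 / 2)) := by simp
        _ ≤ Real.exp L * (2 ^ n * Real.exp (s ^ 2 * r ^ 2 / 2)) := by gcongr
        _ = 2 ^ n * Real.exp K := by rw [hK, Real.exp_add]; ring
    rw [← Finset.sum_div, Finset.sum_add_distrib, ← Finset.sum_div, ← mul_div_assoc]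
    gcongr
    have h4 : (∑ σ : Fin n → Bool, ∑ v ∈ V, Real.exp (s * signedSum σ v)) / Real.exp K
        ≤ 2 ^ n := by
      rwa [div_le_iff₀ (Real.exp_pos _)]
    simp only [Finset.sum_const, Finset.card_univ, Fintype.card_fun, Fintype.card_bool,
      Fintype.card_fin, nsmul_eq_mul, Nat.cast_pow, Nat.cast_ofNat]
    linarith

/-- The chaining step of Dudley's bound: at depth `N` there is a cover of scale `r / 2 ^ N` whose
Rademacher averages are controlled. -/
theorem exists_chain_of_cover {n : ℕ} {ι : Type*} (a : ι → Fin n → ℝ) {r R : ℝ}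
    (hr : 0 < r) (hR : 0 < R) (ha : ∀ g, euclNorm (a g) ≤ r)
    (hcov : ∀ ε : ℝ, 0 < ε → ∃ T : Finset (Fin n → ℝ), (T.card : ℝ) ≤ Real.exp (R / ε ^ 2) ∧
      ∀ g, ∃ t ∈ T, euclNorm (a g - t) ≤ ε) (N : ℕ) :
    ∃ (M : (Fin n → Bool) → ℝ) (T : Finset (Fin n → ℝ)) (t : ι → Fin n → ℝ),
      (T.card : ℝ) ≤ Real.exp (R / (r / 2 ^ N) ^ 2) ∧ (∀ g, t g ∈ T) ∧
      (∀ g, euclNorm (a g - t g) ≤ r / 2 ^ N) ∧ (∀ σ g, signedSum σ (t g) ≤ M σ) ∧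
      ∑ σ, M σ ≤ 2 ^ n * (6 * N * √R) := by
  induction N with
  | zero =>
    refine ⟨fun _ => 0, {0}, fun _ => 0, ?_, by simp, by simpa using ha, ?_, by simp⟩
    · simp only [Finset.card_singleton, Nat.cast_one]
      exact Real.one_le_exp (by positivity)
    · intro σ g
      simp [signedSum]
  | succ N ih =>
    obtain ⟨M, T, t, hT, htT, hta, hM, hMs⟩ := ih
    set α := r / 2 ^ (N + 1) with hα
    have hα0 : 0 < α := by positivity
    have h2α : r / 2 ^ N = 2 * α := by rw [hα, pow_succ]; field_simp
    rw [h2α] at hT hta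
    obtain ⟨T', hT', hc⟩ := hcov α hα0
    choose t' ht'T ht'a using hc
    let V := ((T' ×ˢ T).image fun p => p.1 - p.2).filter fun v => euclNorm v ≤ 3 * α
    have hVc : (V.card : ℝ) ≤ Real.exp (2 * R / α ^ 2) := by
      have h1 : V.card ≤ T'.card * T.card :=
        (Finset.card_filter_le _ _).trans (Finset.card_image_le.trans (Finset.card_product _ _).le)
      calc (V.card : ℝ) ≤ T'.card * T.card := by exact_mod_cast h1
        _ ≤ Real.exp (R / α ^ 2) * Real.exp (R / α ^ 2) := by
          gcongr
          refine hT.trans ?_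
          gcongr
          linarith
        _ = Real.exp (2 * R / α ^ 2) := by rw [← Real.exp_add]; ring_nf
    have hsR : 0 < √R := Real.sqrt_pos.2 hR
    obtain ⟨M', hM', hM's⟩ := exists_signedSum_le_of_finset V (r := 3 * α)
      (s := 2 * √R / (3 * α ^ 2)) (by positivity) (fun v hv => (Finset.mem_filter.1 hv).2) hVc
    refine ⟨fun σ => M σ + M' σ, T', t', hT', ht'T, ht'a, fun σ g => ?_, ?_⟩
    · have hmem : t' g - t g ∈ V := by
        refine Finset.mem_filter.2 ⟨Finset.mem_image.2
          ⟨(t' g, t g), Finset.mem_product.2 ⟨ht'T g, htT g⟩, rfl⟩, ?_⟩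
        linarith [euclNorm_sub_le_add (a g) (t' g) (t g), ht'a g, hta g]
      calc signedSum σ (t' g) = signedSum σ (t g) + signedSum σ (t' g - t g) := by
            rw [← signedSum_add]; simp
        _ ≤ M σ + M' σ := add_le_add (hM σ g) (hM' σ _ hmem)
    · have h1 : (2 * R / α ^ 2 + (2 * √R / (3 * α ^ 2)) ^ 2 * (3 * α) ^ 2 / 2)
          / (2 * √R / (3 * α ^ 2)) = 6 * √R := by
        nth_rewrite 1 [← Real.sq_sqrt hR.le]
        field_simp
        ring
      rw [h1] at hM's
      rw [Finset.sum_add_distrib]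
      push_cast
      linarith

/-- **Dudley's entropy bound** under a covering-number assumption `exp (R / ε ^ 2)`, with the
chaining stopped at depth `N`. -/
theorem exists_signedSum_le_of_cover {n : ℕ} {ι : Type*} (a : ι → Fin n → ℝ) {r R : ℝ}
    (hr : 0 < r) (hR : 0 < R) (ha : ∀ g, euclNorm (a g) ≤ r)
    (hcov : ∀ ε : ℝ, 0 < ε → ∃ T : Finset (Fin n → ℝ), (T.card : ℝ) ≤ Real.exp (R / ε ^ 2) ∧
      ∀ g, ∃ t ∈ T, euclNorm (a g - t) ≤ ε) (N : ℕ) :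
    ∃ M : (Fin n → Bool) → ℝ, (∀ σ g, signedSum σ (a g) ≤ M σ) ∧
      ∑ σ, M σ ≤ 2 ^ n * (√n * (r / 2 ^ N) + 6 * N * √R) := by
  obtain ⟨M, T, t, -, -, hta, hM, hMs⟩ := exists_chain_of_cover a hr hR ha hcov N
  refine ⟨fun σ => √n * (r / 2 ^ N) + M σ, fun σ g => ?_, ?_⟩
  · calc signedSum σ (a g) = signedSum σ (a g - t g) + signedSum σ (t g) := by
          rw [← signedSum_add]; simp
      _ ≤ √n * (r / 2 ^ N) + M σ := by
          refine add_le_add ((signedSum_le σ _).trans ?_) (hM σ g)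
          gcongr
          exact hta g
  · rw [Finset.sum_add_distrib]
    simp only [Finset.sum_const, Finset.card_univ, Fintype.card_fun, Fintype.card_bool,
      Fintype.card_fin, nsmul_eq_mul, Nat.cast_pow, Nat.cast_ofNat]
    linarith

theorem abs_ciSup_le {ι : Type*} [Nonempty ι] {φ : ι → ℝ} {C : ℝ} (h : ∀ g, |φ g| ≤ C) :
    |⨆ g, φ g| ≤ C := by
  obtain ⟨g₀⟩ := ‹Nonempty ι›
  refine abs_le.2 ⟨?_, ciSup_le fun g => (abs_le.1 (h g)).2⟩
  exact le_ciSup_of_le ⟨C, by rintro _ ⟨g, rfl⟩; exact (abs_le.1 (h g)).2⟩ g₀ (abs_le.1 (h g₀)).1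

theorem abs_sum_le_of_abs_le_one {n : ℕ} {u : Fin n → ℝ} (h : ∀ i, |u i| ≤ 1) :
    |∑ i, u i| ≤ n :=
  (Finset.abs_sum_le_sum_abs _ _).trans
    ((Finset.sum_le_sum fun i _ => h i).trans (by simp))

theorem abs_boolSign (b : Bool) : |boolSign b| = 1 := by cases b <;> simp [boolSign]

/-- Exchanging the two samples at the coordinates where the sign is negative does not change the
expected supremum of the symmetrized process. -/
theorem integral_iSup_signedSum_eq {Z : Type*} [MeasurableSpace Z] (μ : Measure Z)
    [IsProbabilityMeasure μ] {n : ℕ} {ι : Type*} (f : ι → Z → ℝ) (σ : Fin n → Bool) :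
    ∫ p, ⨆ g, signedSum σ (fun i => f g (p.2 i) - f g (p.1 i))
        ∂((Measure.pi fun _ : Fin n => μ).prod (Measure.pi fun _ : Fin n => μ))
      = ∫ p, ⨆ g, ∑ i, (f g (p.2 i) - f g (p.1 i))
        ∂((Measure.pi fun _ : Fin n => μ).prod (Measure.pi fun _ : Fin n => μ)) := by
  have he := measurePreserving_arrowProdEquivProdArrow Z Z (Fin n) (fun _ => μ) (fun _ => μ)
  set e := MeasurableEquiv.arrowProdEquivProdArrow Z Z (Fin n)
  let sw : Fin n → (Z × Z ≃ᵐ Z × Z) := fun i =>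
    if σ i then MeasurableEquiv.refl _ else MeasurableEquiv.prodComm
  have hsw : MeasurePreserving (MeasurableEquiv.piCongrRight sw)
      (Measure.pi fun _ : Fin n => μ.prod μ) (Measure.pi fun _ : Fin n => μ.prod μ) := by
    refine measurePreserving_pi _ _ fun i => ?_
    by_cases h : σ i
    · simp only [sw, h, if_true]
      exact MeasurePreserving.id _
    · simp only [sw, h]
      exact Measure.measurePreserving_swap
  rw [← he.integral_comp', ← he.integral_comp', ← hsw.integral_comp']
  congr 1 with w
  congr 1 with g
  refine Finset.sum_congr rfl fun i _ => ?_
  by_cases h : σ i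
  · simp [e, sw, h, boolSign, MeasurableEquiv.arrowProdEquivProdArrow,
      Equiv.arrowProdEquivProdArrow, MeasurableEquiv.piCongrRight]
  · simp [e, sw, h, boolSign, MeasurableEquiv.arrowProdEquivProdArrow,
      Equiv.arrowProdEquivProdArrow, MeasurableEquiv.piCongrRight, MeasurableEquiv.prodComm]

/-- **Symmetrization**: the expected uniform deviation is at most twice any uniform bound on the
Rademacher averages. -/
theorem integral_iSup_deviation_le {Z : Type*} [MeasurableSpace Z] (μ : Measure Z)
    [IsProbabilityMeasure μ] {n : ℕ} {ι : Type*} [Countable ι] [Nonempty ι] (f : ι → Z → ℝ)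
    (hf : ∀ g, Measurable (f g)) (h01 : ∀ g x, f g x ∈ Set.Icc (0 : ℝ) 1) {B : ℝ}
    (hB : ∀ z : Fin n → Z, ∃ M : (Fin n → Bool) → ℝ,
      (∀ σ g, signedSum σ (fun i => f g (z i)) ≤ M σ) ∧ ∑ σ, M σ ≤ 2 ^ n * B) :
    ∫ z, ⨆ g, ∑ i, (∫ x, f g x ∂μ - f g (z i)) ∂(Measure.pi fun _ : Fin n => μ) ≤ 2 * B := by
  set π := Measure.pi fun _ : Fin n => μ
  let H : (Fin n → Bool) → (Fin n → Z) × (Fin n → Z) → ℝ := fun σ p =>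
    ⨆ g, signedSum σ (fun i => f g (p.2 i) - f g (p.1 i))
  let H₁ : (Fin n → Z) × (Fin n → Z) → ℝ := fun p => ⨆ g, ∑ i, (f g (p.2 i) - f g (p.1 i))
  have hsub : ∀ g x y, |f g x - f g y| ≤ 1 := fun g x y => by
    have h1 := h01 g x
    have h2 := h01 g y
    exact abs_le.2 ⟨by linarith [h1.1, h2.2], by linarith [h1.2, h2.1]⟩
  have hfi : ∀ g, Integrable (f g) μ := fun g =>
    Integrable.of_mem_Icc 0 1 (hf g).aemeasurable (ae_of_all _ (h01 g))
  have habs₁ : ∀ g (p : (Fin n → Z) × (Fin n → Z)),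
      |∑ i, (f g (p.2 i) - f g (p.1 i))| ≤ n := fun g p =>
    abs_sum_le_of_abs_le_one fun i => hsub g _ _
  have hHi : ∀ σ, Integrable (H σ) (π.prod π) := fun σ => by
    refine Integrable.of_bound (C := n) (Measurable.aestronglyMeasurable ?_)
      (ae_of_all _ fun p => abs_ciSup_le fun g => abs_sum_le_of_abs_le_one fun i => ?_)
    · refine Measurable.iSup fun g => ?_
      have := hf g
      unfold signedSum
      fun_prop
    · rw [abs_mul, abs_boolSign, one_mul]
      exact hsub g _ _
  have hH₁m : Measurable H₁ := by
    refine Measurable.iSup fun g => ?_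
    have := hf g
    fun_prop
  have hH₁ : ∀ p, |H₁ p| ≤ n := fun p => abs_ciSup_le fun g => habs₁ g p
  have hH₁i : Integrable H₁ (π.prod π) :=
    Integrable.of_bound hH₁m.aestronglyMeasurable n (ae_of_all _ hH₁)
  have hghost : ∫ z, ⨆ g, ∑ i, (∫ x, f g x ∂μ - f g (z i)) ∂π ≤ ∫ p, H₁ p ∂(π.prod π) := by
    rw [integral_prod _ hH₁i]
    have hsec : ∀ z, Integrable (fun y => H₁ (z, y)) π := fun z =>
      Integrable.of_bound (hH₁m.comp measurable_prodMk_left).aestronglyMeasurable n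
        (ae_of_all _ fun y => hH₁ (z, y))
    have hdev : ∀ (z : Fin n → Z) g,
        ∑ i, (∫ x, f g x ∂μ - f g (z i)) = ∫ y, ∑ i, (f g (y i) - f g (z i)) ∂π := by
      intro z g
      have hev : ∀ i, MeasurePreserving (fun y : Fin n → Z => y i) π μ := fun i =>
        measurePreserving_eval _ i
      have hevi : ∀ i, Integrable (fun y : Fin n → Z => f g (y i)) π := fun i =>
        (hev i).integrable_comp_of_integrable (hfi g)
      have hmap : ∀ i, ∫ y : Fin n → Z, f g (y i) ∂π = ∫ x, f g x ∂μ := fun i => by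
        rw [← (hev i).map_eq, integral_map (hev i).aemeasurable (hf g).aestronglyMeasurable]
      have hsi : ∀ i, Integrable (fun y : Fin n → Z => f g (y i) - f g (z i)) π := fun i =>
        (hevi i).sub (integrable_const _)
      rw [integral_finsetSum _ fun i _ => hsi i]
      refine Finset.sum_congr rfl fun i _ => ?_
      rw [integral_sub (hevi i) (integrable_const _), hmap]
      simp
    have hle : ∀ z g, ∑ i, (∫ x, f g x ∂μ - f g (z i)) ≤ ∫ y, H₁ (z, y) ∂π := by
      intro z g
      rw [hdev]
      refine integral_mono ?_ (hsec z) fun y => ?_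
      · refine Integrable.of_bound (C := n) (Measurable.aestronglyMeasurable ?_)
          (ae_of_all _ fun y => habs₁ g (z, y))
        have := hf g
        fun_prop
      · exact le_ciSup (f := fun g => ∑ i, (f g (y i) - f g (z i)))
          ⟨n, by rintro _ ⟨g, rfl⟩; exact (abs_le.1 (habs₁ g (z, y))).2⟩ g
    refine integral_mono ?_ hH₁i.integral_prod_left fun z => ciSup_le (hle z)
    refine Integrable.of_bound (C := n) (Measurable.aestronglyMeasurable ?_)
      (ae_of_all _ fun z => abs_ciSup_le fun g => ?_)
    · refine Measurable.iSup fun g => ?_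
      have := hf g
      fun_prop
    · rw [hdev]
      simpa using norm_integral_le_of_norm_le_const (μ := π) (C := n)
        (f := fun y => ∑ i, (f g (y i) - f g (z i))) (ae_of_all _ fun y => habs₁ g (z, y))
  have hpt : ∀ p, ∑ σ, H σ p ≤ 2 ^ n * (2 * B) := by
    intro p
    obtain ⟨M, hM, hMs⟩ := hB p.2
    obtain ⟨M', hM', hMs'⟩ := hB p.1
    calc ∑ σ, H σ p ≤ ∑ σ, (M σ + M' (fun i => !σ i)) := by
          refine Finset.sum_le_sum fun σ _ => ciSup_le fun g => ?_
          have := signedSum_sub σ (fun i => f g (p.2 i)) (fun i => f g (p.1 i))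
          exact this.trans_le (add_le_add (hM _ g) (hM' _ g))
      _ = ∑ σ, M σ + ∑ σ, M' σ := by
          rw [Finset.sum_add_distrib]
          congr 1
          exact (Equiv.piCongrRight fun _ : Fin n => Equiv.boolNot).sum_comp M'
      _ ≤ 2 ^ n * (2 * B) := by linarith
  have hcomm : (2 : ℝ) ^ n * ∫ p, H₁ p ∂(π.prod π) ≤ 2 ^ n * (2 * B) := by
    calc (2 : ℝ) ^ n * ∫ p, H₁ p ∂(π.prod π) = ∑ σ, ∫ p, H σ p ∂(π.prod π) := by
          have : ∀ σ, ∫ p, H σ p ∂(π.prod π) = ∫ p, H₁ p ∂(π.prod π) := fun σ =>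
            integral_iSup_signedSum_eq μ f σ
          simp [this]
      _ = ∫ p, ∑ σ, H σ p ∂(π.prod π) := (integral_finsetSum _ fun σ _ => hHi σ).symm
      _ ≤ ∫ _, 2 ^ n * (2 * B) ∂(π.prod π) :=
          integral_mono (integrable_finsetSum _ fun σ _ => hHi σ) (integrable_const _) hpt
      _ = 2 ^ n * (2 * B) := by simp
  exact hghost.trans (le_of_mul_le_mul_left hcomm (by positivity))

theorem iSup_deviation_update_sub_le {Z : Type*} {n : ℕ} {ι : Type*} [Nonempty ι]
    (f : ι → Z → ℝ) (h01 : ∀ g x, f g x ∈ Set.Icc (0 : ℝ) 1) (m : ι → ℝ)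
    (hm : ∀ g, m g ∈ Set.Icc (0 : ℝ) 1) (z : Fin n → Z) (i : Fin n) (x : Z) :
    |(⨆ g, ∑ j, (m g - f g (Function.update z i x j))) - ⨆ g, ∑ j, (m g - f g (z j))| ≤ 1 := by
  have hbdd : ∀ w : Fin n → Z, BddAbove (Set.range fun g => ∑ j, (m g - f g (w j))) := fun w => by
    refine ⟨∑ _j : Fin n, 1, ?_⟩
    rintro _ ⟨g, rfl⟩
    exact Finset.sum_le_sum fun j _ => by linarith [(hm g).2, (h01 g (w j)).1]
  have hterm : ∀ g, ∑ j, (m g - f g (Function.update z i x j))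
      = ∑ j, (m g - f g (z j)) + (f g (z i) - f g x) := fun g => by
    rw [← Finset.add_sum_erase _ _ (Finset.mem_univ i),
      ← Finset.add_sum_erase _ (fun j => m g - f g (z j)) (Finset.mem_univ i),
      Function.update_self]
    have : ∑ j ∈ Finset.univ.erase i, (m g - f g (Function.update z i x j))
        = ∑ j ∈ Finset.univ.erase i, (m g - f g (z j)) :=
      Finset.sum_congr rfl fun j hj => by rw [Function.update_of_ne (Finset.ne_of_mem_erase hj)]
    rw [this]
    ring
  refine abs_sub_le_iff.2 ⟨?_, ?_⟩
  · rw [sub_le_iff_le_add]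
    refine ciSup_le fun g => ?_
    have := le_ciSup (hbdd z) g
    linarith [hterm g, (h01 g (z i)).2, (h01 g x).1]
  · rw [sub_le_iff_le_add]
    refine ciSup_le fun g => ?_
    have := le_ciSup (hbdd (Function.update z i x)) g
    linarith [hterm g, (h01 g (z i)).1, (h01 g x).2]

/-- Concentration of the uniform deviation around its expectation. -/
theorem measureReal_iSup_deviation_ge_le {Z : Type*} [MeasurableSpace Z] (μ : Measure Z)
    [IsProbabilityMeasure μ] {n : ℕ} {ι : Type*} [Countable ι] [Nonempty ι] (f : ι → Z → ℝ)
    (hf : ∀ g, Measurable (f g)) (h01 : ∀ g x, f g x ∈ Set.Icc (0 : ℝ) 1) {F : (Fin n → Z) → ℝ}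
    (hF : F = fun z => ⨆ g, ∑ i, (∫ x, f g x ∂μ - f g (z i))) {s : ℝ} (hs : 0 ≤ s) :
    (Measure.pi fun _ : Fin n => μ).real
      {z | s ≤ F z - ∫ y, F y ∂Measure.pi fun _ : Fin n => μ} ≤ Real.exp (-2 * s ^ 2 / n) := by
  have hm : ∀ g, ∫ x, f g x ∂μ ∈ Set.Icc (0 : ℝ) 1 := fun g =>
    ⟨integral_nonneg fun x => (h01 g x).1, by
      have := integral_mono_of_nonneg (μ := μ) (ae_of_all _ fun x => (h01 g x).1)
        (integrable_const (1 : ℝ)) (ae_of_all _ fun x => (h01 g x).2)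
      simpa using this⟩
  have hFm : Measurable F := by
    rw [hF]
    refine Measurable.iSup fun g => ?_
    have := hf g
    fun_prop
  have h := (hasSubgaussianMGF_pi_of_bounded_difference μ 1 n F hFm n (fun z => by
    rw [hF]
    refine abs_ciSup_le fun g => abs_sum_le_of_abs_le_one fun i => ?_
    have h1 := h01 g (z i)
    have h2 := hm g
    exact abs_le.2 ⟨by linarith [h1.2, h2.1], by linarith [h1.1, h2.2]⟩) (fun z i x => by
    rw [hF]
    exact iSup_deviation_update_sub_le f h01 _ hm z i x)).measure_ge_le hs
  refine h.trans_eq ?_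
  congr 1
  push_cast
  rcases Nat.eq_zero_or_pos n with rfl | hn
  · simp
  · field_simp

theorem clog_two_le_three_mul_log {n : ℕ} (hn : 2 ≤ n) : (Nat.clog 2 n : ℝ) ≤ 3 * Real.log n := by
  have h1 : 2 ^ (Nat.clog 2 n) ≤ n ^ 2 := by
    have h2 := Nat.pow_pred_clog_lt_self (b := 2) (by norm_num) (x := n) (by omega)
    have h3 : 0 < Nat.clog 2 n := Nat.clog_pos (by norm_num) hn
    obtain ⟨k, hk⟩ := Nat.exists_eq_succ_of_ne_zero h3.ne'
    rw [hk] at h2 ⊢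
    simp only [Nat.pred_succ] at h2
    rw [Nat.succ_eq_add_one, pow_succ]
    nlinarith
  have h4 : (Nat.clog 2 n : ℝ) * Real.log 2 ≤ 2 * Real.log n := by
    have := Real.log_le_log (by positivity) (show (2 : ℝ) ^ (Nat.clog 2 n) ≤ (n : ℝ) ^ 2 by
      exact_mod_cast h1)
    simpa [Real.log_pow] using this
  nlinarith [Real.log_two_gt_d9, (Nat.cast_nonneg (Nat.clog 2 n) : (0 : ℝ) ≤ _)]

/-- (Generalization bound under a covering-number assumption;
abstract form of the paper's Theorem 2.) Let `G` be a nonempty countable family of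
measurable functions `g : Z → [0,1]` containing the zero function, and suppose
`R > 0` is such that for every sample `z ∈ Zⁿ` and every `ε > 0`, the output class
`G(z) = {(g(z₁), …, g(zₙ)) : g ∈ G} ⊆ ℝⁿ` admits an `ε`-cover (Euclidean norm) of
cardinality at most `exp(R/ε²)`. Then for every `δ ∈ (0,1)`, with probability at
least `1 - δ` over `z ∼ μ^⊗n`, simultaneously for all `g ∈ G`:
`E[g] ≤ (1/n)·Σᵢ g(zᵢ) + 8/n^{3/2} + (36/n)·√R·log n + 3·√(log(2/δ)/(2n))`. -/
theorem generalization_bound_from_covering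
    {Z : Type*} [MeasurableSpace Z] (μ : Measure Z) [IsProbabilityMeasure μ]
    (n : ℕ) (hn : 1 ≤ n)
    (G : Set (Z → ℝ)) (hGne : G.Nonempty) (hGct : G.Countable)
    (hG0 : (fun _ : Z => (0 : ℝ)) ∈ G)
    (hGmeas : ∀ g ∈ G, Measurable g)
    (hGrange : ∀ g ∈ G, ∀ z : Z, g z ∈ Set.Icc (0 : ℝ) 1)
    (R : ℝ) (hR : 0 < R)
    (hcov : ∀ z : Fin n → Z, ∀ ε : ℝ, 0 < ε →
      ∃ T : Finset (Fin n → ℝ), (T.card : ℝ) ≤ Real.exp (R / ε ^ 2) ∧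
        ∀ g ∈ G, ∃ t ∈ T, euclNorm ((fun i => g (z i)) - t) ≤ ε)
    (δ : ℝ) (hδ : δ ∈ Set.Ioo (0 : ℝ) 1) :
    ENNReal.ofReal (1 - δ) ≤
      Measure.pi (fun _ : Fin n => μ)
        {z : Fin n → Z | ∀ g ∈ G,
          ∫ x, g x ∂μ ≤ (1 / (n : ℝ)) * ∑ i, g (z i)
            + 8 / (n : ℝ) ^ ((3 : ℝ) / 2)
            + (36 / n) * Real.sqrt R * Real.log n
            + 3 * Real.sqrt (Real.log (2 / δ) / (2 * n))} := by
  have hn0 : (0 : ℝ) < n := by exact_mod_cast hn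
  have hlogn : 0 ≤ Real.log n := Real.log_natCast_nonneg n
  have hRs : 0 ≤ 36 / n * √R * Real.log n := by positivity
  set t := √(Real.log (2 / δ) / (2 * n))
  have ht0 : 0 ≤ t := Real.sqrt_nonneg _
  have h8 : 0 ≤ 8 / (n : ℝ) ^ ((3 : ℝ) / 2) := by positivity
  rcases le_or_gt n 4 with hn4 | hn4
  · have h8' : 1 ≤ 8 / (n : ℝ) ^ ((3 : ℝ) / 2) := by
      rw [le_div_iff₀ (by positivity), one_mul]
      calc (n : ℝ) ^ ((3 : ℝ) / 2) ≤ (4 : ℝ) ^ ((3 : ℝ) / 2) := by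
            gcongr
            exact_mod_cast hn4
        _ = 8 := by
            rw [show (4 : ℝ) = 2 ^ (2 : ℝ) by norm_num, ← Real.rpow_mul (by norm_num)]
            norm_num
    have huniv : {z : Fin n → Z | ∀ g ∈ G, ∫ x, g x ∂μ ≤ (1 / (n : ℝ)) * ∑ i, g (z i)
        + 8 / (n : ℝ) ^ ((3 : ℝ) / 2) + (36 / n) * √R * Real.log n + 3 * t} = Set.univ := by
      refine Set.eq_univ_of_forall fun z g hg => ?_
      have h1 : ∫ x, g x ∂μ ≤ 1 := by
        have := integral_mono_of_nonneg (μ := μ) (ae_of_all _ fun x => (hGrange g hg x).1)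
          (integrable_const (1 : ℝ)) (ae_of_all _ fun x => (hGrange g hg x).2)
        simpa using this
      have h2 : 0 ≤ (1 / (n : ℝ)) * ∑ i, g (z i) :=
        mul_nonneg (by positivity) (Finset.sum_nonneg fun i _ => (hGrange g hg _).1)
      linarith
    rw [huniv, measure_univ]
    exact ENNReal.ofReal_le_one.2 (by linarith [hδ.1])
  have hGc : Countable G := hGct.to_subtype
  have hGn : Nonempty G := hGne.to_subtype
  let f : G → Z → ℝ := fun g => g
  have hf : ∀ g, Measurable (f g) := fun g => hGmeas g g.2
  have h01 : ∀ g x, f g x ∈ Set.Icc (0 : ℝ) 1 := fun g x => hGrange g g.2 x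
  set N := Nat.clog 2 n
  set B := √n * (√n / 2 ^ N) + 6 * N * √R with hBdef
  have hB := integral_iSup_deviation_le (n := n) μ f hf h01 (B := B) fun z => by
    refine exists_signedSum_le_of_cover (fun g i => f g (z i)) (Real.sqrt_pos.2 hn0) hR
      (fun g => Real.sqrt_le_sqrt ?_) (fun ε hε => ?_) N
    · calc ∑ i, f g (z i) ^ 2 ≤ ∑ _i : Fin n, (1 : ℝ) :=
            Finset.sum_le_sum fun i _ => pow_le_one₀ (h01 g _).1 (h01 g _).2
        _ = n := by simp
    · obtain ⟨T, hT, hc⟩ := hcov z ε hε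
      exact ⟨T, hT, fun g => hc g g.2⟩
  have hBle : B ≤ 1 + 18 * √R * Real.log n := by
    have h1 : √n * (√n / 2 ^ N) ≤ 1 := by
      rw [← mul_div_assoc, Real.mul_self_sqrt hn0.le, div_le_one (by positivity)]
      exact_mod_cast Nat.le_pow_clog (by norm_num) n
    have h2 := mul_le_mul_of_nonneg_right (clog_two_le_three_mul_log (n := n) (by omega))
      (Real.sqrt_nonneg R)
    rw [hBdef]
    nlinarith
  have hδ0 := hδ.1
  have hlog : Real.log 2 ≤ Real.log (2 / δ) :=
    Real.log_le_log (by norm_num) (by rw [le_div_iff₀ hδ0]; linarith [hδ.2])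
  have htsq : t ^ 2 = Real.log (2 / δ) / (2 * n) :=
    Real.sq_sqrt (div_nonneg ((Real.log_nonneg (by norm_num)).trans hlog) (by positivity))
  have hnt : 1 ≤ n * t := by
    have h5 : (5 : ℝ) ≤ n := by exact_mod_cast hn4
    have h1 : (n * t) ^ 2 = n * Real.log (2 / δ) / 2 := by
      rw [mul_pow, htsq]; field_simp
    have h2 : 1 ≤ (n * t) ^ 2 := by
      rw [h1]
      nlinarith [Real.log_two_gt_d9]
    nlinarith [mul_nonneg hn0.le ht0]
  set F : (Fin n → Z) → ℝ := fun z => ⨆ g, ∑ i, (∫ x, f g x ∂μ - f g (z i)) with hF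
  set π := Measure.pi fun _ : Fin n => μ
  have hFm : Measurable F := by
    refine Measurable.iSup fun g => ?_
    have := hf g
    fun_prop
  have hconc := measureReal_iSup_deviation_ge_le μ f hf h01 hF (s := n * t) (by positivity)
  set S := {z | n * t ≤ F z - ∫ y, F y ∂π}
  have hSm : MeasurableSet S := measurableSet_le measurable_const (hFm.sub_const _)
  have hSδ : π.real S ≤ δ := by
    refine hconc.trans ?_
    have h1 : -2 * (n * t) ^ 2 / n = -Real.log (2 / δ) := by
      rw [mul_pow, htsq]; field_simp
    rw [h1, Real.exp_neg, Real.exp_log (by positivity), inv_div]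
    linarith
  have hsub : Sᶜ ⊆ {z : Fin n → Z | ∀ g ∈ G, ∫ x, g x ∂μ ≤ (1 / (n : ℝ)) * ∑ i, g (z i)
      + 8 / (n : ℝ) ^ ((3 : ℝ) / 2) + (36 / n) * √R * Real.log n + 3 * t} := by
    intro z hz g hg
    have hz' : F z - ∫ y, F y ∂π < n * t := not_le.1 hz
    have hle : ∑ i, (∫ x, g x ∂μ - g (z i)) ≤ F z := by
      refine le_ciSup (f := fun g : G => ∑ i, (∫ x, f g x ∂μ - f g (z i)))
        ⟨∑ _i : Fin n, 1, ?_⟩ ⟨g, hg⟩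
      rintro _ ⟨g', rfl⟩
      refine Finset.sum_le_sum fun i _ => ?_
      have h1 := integral_mono_of_nonneg (μ := μ) (ae_of_all _ fun x => (h01 g' x).1)
        (integrable_const (1 : ℝ)) (ae_of_all _ fun x => (h01 g' x).2)
      simp only [integral_const, probReal_univ, one_smul] at h1
      linarith [(h01 g' (z i)).1]
    rw [Finset.sum_sub_distrib] at hle
    simp only [Finset.sum_const, Finset.card_univ, Fintype.card_fin, nsmul_eq_mul] at hle
    have hmain : n * ∫ x, g x ∂μ ≤ ∑ i, g (z i) + 36 * √R * Real.log n + 3 * (n * t) := by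
      linarith
    have hdiv : ∫ x, g x ∂μ ≤ (∑ i, g (z i) + 36 * √R * Real.log n + 3 * (n * t)) / n := by
      rw [le_div_iff₀ hn0]
      linarith
    have heq : (∑ i, g (z i) + 36 * √R * Real.log n + 3 * (n * t)) / n
        = (1 / (n : ℝ)) * ∑ i, g (z i) + (36 / n) * √R * Real.log n + 3 * t := by
      field_simp
    linarith
  refine le_trans ?_ (measure_mono hsub)
  rw [← ofReal_measureReal, probReal_compl_eq_one_sub hSm]
  exact ENNReal.ofReal_le_ofReal (by linarith)
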